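/- (Position-based lower bound) Let i ∈ V_c and let k be a position with n − |S_i| < k ≤ n. Then every repair sequence σ that visits vertex i at the k-th position (σ(k) = i) has total service disruption time T(σ) ≥ L_i^k, where L_i^k = ∑_{p=1}^{n−|S_i|} (n−p+1) s_p + ∑_{p=k+1}^{n} (n−p+1) s_p + |S_i| · ∑_{p=n−|S_i|+1}^{k} s_p. -/

import Mathlib

/-- `W n pre S` is the number of vertices of `V_c = {1,…,n}` without power service
when exactly the vertices in `S` have been repaired: vertices `j` having some
predecessor-or-self `i` (i.e. `pre i j`) that is not in `S`. -/
noncomputable def W (n : ℕ) (pre : ℕ → ℕ → Prop) (S : Finset ℕ) : ℕ :=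
  {j | j ∈ Finset.Icc 1 n ∧ ∃ i ∈ Finset.Icc 1 n, pre i j ∧ i ∉ S}.ncard

/-- `jseq σ p` is the `p`-th visited vertex: the depot `0` for `p = 0`, and `σ p` otherwise. -/
def jseq (σ : ℕ → ℕ) (p : ℕ) : ℕ := if p = 0 then 0 else σ p

/-- Arrival time at the `p`-th visited vertex: `t_p = ∑_{q=1}^p d(j_{q-1}, j_q)`. -/
def arrival (d : ℕ → ℕ → ℝ) (σ : ℕ → ℕ) (p : ℕ) : ℝ :=
  ∑ q ∈ Finset.Icc 1 p, d (jseq σ (q - 1)) (jseq σ q)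

/-- `lastPos n pre σ i = max { p ∈ [1,n] : σ p ⪰ i }`, the position at which the
service of vertex `i` is restored. -/
noncomputable def lastPos (n : ℕ) (pre : ℕ → ℕ → Prop) (σ : ℕ → ℕ) (i : ℕ) : ℕ :=
  sSup {p : ℕ | p ∈ Finset.Icc 1 n ∧ pre (σ p) i}

/-- Total service disruption time `T(σ) = ∑_{i ∈ V_c} r_i` where `r_i = t_{p(i)}`. -/
noncomputable def totalT (n : ℕ) (d : ℕ → ℕ → ℝ) (pre : ℕ → ℕ → Prop) (σ : ℕ → ℕ) : ℝ :=
  ∑ i ∈ Finset.Icc 1 n, arrival d σ (lastPos n pre σ i)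

/-- `Scard n pre i = |S_i|`, the number of successors of `i` in the power network,
including `i` itself. -/
noncomputable def Scard (n : ℕ) (pre : ℕ → ℕ → Prop) (i : ℕ) : ℕ :=
  {j | j ∈ Finset.Icc 1 n ∧ pre i j}.ncard

/-- The multiset of all arc lengths `d(i,j)` over ordered pairs of distinct vertices of `V`. -/
def arcLengths (n : ℕ) (d : ℕ → ℕ → ℝ) : Multiset ℝ :=
  ((Finset.Icc 0 n ×ˢ Finset.Icc 0 n).filter fun x => x.1 ≠ x.2).val.map fun x => d x.1 x.2

/-- `sArc n d p` is the `p`-th smallest arc length (counted with multiplicity). -/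
noncomputable def sArc (n : ℕ) (d : ℕ → ℕ → ℝ) (p : ℕ) : ℝ :=
  ((arcLengths n d).sort (· ≤ ·)).getD (p - 1) 0

/-- The position-based lower bound
`L_i^k = ∑_{p=1}^{n−|S_i|} (n−p+1) s_p + ∑_{p=k+1}^{n} (n−p+1) s_p + |S_i| · ∑_{p=n−|S_i|+1}^{k} s_p`. -/
noncomputable def Lik (n : ℕ) (d : ℕ → ℕ → ℝ) (pre : ℕ → ℕ → Prop) (i k : ℕ) : ℝ :=
  (∑ p ∈ Finset.Icc 1 (n - Scard n pre i), ((n - p + 1 : ℕ) : ℝ) * sArc n d p)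
    + (∑ p ∈ Finset.Icc (k + 1) n, ((n - p + 1 : ℕ) : ℝ) * sArc n d p)
    + (Scard n pre i : ℝ) * ∑ p ∈ Finset.Icc (n - Scard n pre i + 1) k, sArc n d p

theorem List.sum_take_eq_sum_range_getD {M : Type*} [AddCommMonoid M] (l : List M) (m : ℕ) :
    (l.take m).sum = ∑ p ∈ Finset.range m, l.getD p 0 := by
  induction l generalizing m with
  | nil => simp
  | cons a l ih =>
    cases m with
    | zero => simp
    | succ m =>
      rw [Finset.sum_range_succ', List.take_succ_cons, List.sum_cons, ih, add_comm]
      simp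

/-- The first terms of a sorted list have the smallest sum among sublists of the same length. -/
theorem List.Sublist.sum_take_length_le {M : Type*} [AddCommMonoid M] [PartialOrder M]
    [IsOrderedAddMonoid M] {l₁ l₂ : List M} (h : l₁.Sublist l₂) (hs : l₂.Pairwise (· ≤ ·)) :
    (l₂.take l₁.length).sum ≤ l₁.sum := by
  induction l₂ generalizing l₁ with
  | nil => simp [List.sublist_nil.mp h]
  | cons a l₂ ih =>
    cases l₁ with
    | nil => simp
    | cons b l₁ =>
      obtain ⟨ha, hs⟩ := List.pairwise_cons.mp hs
      have hab : a ≤ b := by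
        rcases List.mem_cons.mp (h.subset List.mem_cons_self) with rfl | hb
        · exact le_rfl
        · exact ha b hb
      simpa using add_le_add hab (ih h.tail hs)

/-- The sum of a sub-multiset is at least that of the same number of smallest elements. -/
theorem Multiset.sum_take_sort_le {M : Type*} [AddCommMonoid M] [LinearOrder M]
    [IsOrderedAddMonoid M] {s t : Multiset M} (h : s ≤ t) :
    ((t.sort (· ≤ ·)).take s.card).sum ≤ s.sum := by
  have hsub : (s.sort (· ≤ ·)).Sublist (t.sort (· ≤ ·)) := by
    refine List.sublist_of_subperm_of_pairwise ?_ (s.pairwise_sort (· ≤ ·))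
      (t.pairwise_sort (· ≤ ·))
    rw [← Multiset.coe_le]
    simpa using h
  have := hsub.sum_take_length_le (t.pairwise_sort (· ≤ ·))
  rwa [Multiset.length_sort, ← Multiset.sum_coe (s.sort (· ≤ ·)), Multiset.sort_eq] at this

theorem sArc_nonneg {d : ℕ → ℕ → ℝ} (hd : ∀ i j, 0 ≤ d i j) (n p : ℕ) : 0 ≤ sArc n d p := by
  unfold sArc
  rw [List.getD_eq_getElem?_getD]
  rcases h : ((arcLengths n d).sort (· ≤ ·))[p - 1]? with _ | x
  · simp
  · have hx := List.mem_of_getElem? h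
    rw [Multiset.mem_sort, arcLengths, Multiset.mem_map] at hx
    obtain ⟨y, -, rfl⟩ := hx
    exact hd _ _

theorem sum_sArc_eq_sum_take (n : ℕ) (d : ℕ → ℕ → ℝ) (m : ℕ) :
    ∑ p ∈ Finset.Icc 1 m, sArc n d p = (((arcLengths n d).sort (· ≤ ·)).take m).sum := by
  rw [List.sum_take_eq_sum_range_getD, Finset.range_eq_Ico, ← Finset.Ico_add_one_right_eq_Icc,
    Finset.sum_Ico_eq_sum_range, Finset.sum_Ico_eq_sum_range]
  simp [sArc]

/-- The legs of a repair sequence are pairwise different arcs. -/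
theorem legs_le_arcLengths {n : ℕ} (d : ℕ → ℕ → ℝ) {σ : ℕ → ℕ}
    (hσ : Set.BijOn σ (Set.Icc 1 n) (Set.Icc 1 n)) {m : ℕ} (hm : m ≤ n) :
    (Finset.Icc 1 m).val.map (fun q => d (jseq σ (q - 1)) (jseq σ q)) ≤ arcLengths n d := by
  have hpos {q : ℕ} (h1 : 1 ≤ q) (hq : q ≤ n) : jseq σ q = σ q ∧ 1 ≤ σ q ∧ σ q ≤ n :=
    ⟨if_neg (by omega), hσ.mapsTo ⟨h1, hq⟩⟩
  have hinj : Set.InjOn (fun q => (jseq σ (q - 1), jseq σ q)) (Finset.Icc 1 m) := by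
    intro a ha b hb hab
    simp only [Finset.coe_Icc, Set.mem_Icc] at ha hb
    have h := congrArg Prod.snd hab
    simp only [(hpos ha.1 (ha.2.trans hm)).1, (hpos hb.1 (hb.2.trans hm)).1] at h
    exact hσ.injOn ⟨ha.1, ha.2.trans hm⟩ ⟨hb.1, hb.2.trans hm⟩ h
  have hmap : (Finset.Icc 1 m).val.map (fun q => d (jseq σ (q - 1)) (jseq σ q)) =
      ((Finset.Icc 1 m).image fun q => (jseq σ (q - 1), jseq σ q)).val.map
        fun x => d x.1 x.2 := by
    rw [Finset.image_val_of_injOn hinj, Multiset.map_map]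
    rfl
  rw [hmap, arcLengths]
  refine Multiset.map_le_map (Finset.val_le_iff.mpr fun x hx => ?_)
  obtain ⟨q, hq, rfl⟩ := Finset.mem_image.mp hx
  obtain ⟨h1, h2⟩ := Finset.mem_Icc.mp hq
  obtain ⟨hq, hq1, hqn⟩ := hpos h1 (h2.trans hm)
  simp only [Finset.mem_filter, Finset.mem_product, Finset.mem_Icc, hq]
  rcases Nat.eq_or_lt_of_le h1 with rfl | h1
  · simp only [jseq, Nat.sub_self, if_true]
    omega
  · obtain ⟨hr, hr1, hrn⟩ := hpos (q := q - 1) (by omega) (by omega)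
    rw [hr]
    refine ⟨by omega, fun h => ?_⟩
    have := hσ.injOn ⟨by omega, by omega⟩ ⟨by omega, by omega⟩ h
    omega

theorem sum_sArc_le_arrival {n : ℕ} (d : ℕ → ℕ → ℝ) {σ : ℕ → ℕ}
    (hσ : Set.BijOn σ (Set.Icc 1 n) (Set.Icc 1 n)) {m : ℕ} (hm : m ≤ n) :
    ∑ p ∈ Finset.Icc 1 m, sArc n d p ≤ arrival d σ m := by
  have h := Multiset.sum_take_sort_le (legs_le_arcLengths d hσ hm)
  rw [Multiset.card_map, Finset.card_val, Nat.card_Icc, Nat.add_sub_cancel] at h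
  rw [sum_sArc_eq_sum_take]
  exact h

theorem lastPos_le (n : ℕ) (pre : ℕ → ℕ → Prop) (σ : ℕ → ℕ) (j : ℕ) : lastPos n pre σ j ≤ n :=
  csSup_le' fun _ hp => (Finset.mem_Icc.mp hp.1).2

theorem le_lastPos {n : ℕ} {pre : ℕ → ℕ → Prop} {σ : ℕ → ℕ} {p j : ℕ}
    (hp : p ∈ Finset.Icc 1 n) (h : pre (σ p) j) : p ≤ lastPos n pre σ j :=
  le_csSup ⟨n, fun _ hq => (Finset.mem_Icc.mp hq.1).2⟩ ⟨hp, h⟩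

/-- The number of vertices without service while the `p`-th leg is travelled. -/
noncomputable def numUnserved (n : ℕ) (pre : ℕ → ℕ → Prop) (σ : ℕ → ℕ) (p : ℕ) : ℕ :=
  {j ∈ Finset.Icc 1 n | p ≤ lastPos n pre σ j}.card

theorem sum_numUnserved_mul_sArc_le_totalT {n : ℕ} (d : ℕ → ℕ → ℝ) (pre : ℕ → ℕ → Prop)
    {σ : ℕ → ℕ} (hσ : Set.BijOn σ (Set.Icc 1 n) (Set.Icc 1 n)) :
    ∑ p ∈ Finset.Icc 1 n, (numUnserved n pre σ p : ℝ) * sArc n d p ≤ totalT n d pre σ := by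
  calc ∑ p ∈ Finset.Icc 1 n, (numUnserved n pre σ p : ℝ) * sArc n d p
      = ∑ p ∈ Finset.Icc 1 n, ∑ j ∈ Finset.Icc 1 n with p ≤ lastPos n pre σ j, sArc n d p := by
        simp [numUnserved]
    _ = ∑ j ∈ Finset.Icc 1 n, ∑ p ∈ Finset.Icc 1 (lastPos n pre σ j), sArc n d p := by
        refine Finset.sum_comm' fun p j => ?_
        have := lastPos_le n pre σ j
        simp only [Finset.mem_filter, Finset.mem_Icc]
        omega
    _ ≤ totalT n d pre σ :=
        Finset.sum_le_sum fun j _ => sum_sArc_le_arrival d hσ (lastPos_le n pre σ j)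

theorem le_numUnserved {n : ℕ} {pre : ℕ → ℕ → Prop} (hrefl : ∀ i ∈ Finset.Icc 1 n, pre i i)
    {σ : ℕ → ℕ} (hσ : Set.BijOn σ (Set.Icc 1 n) (Set.Icc 1 n)) {p : ℕ}
    (hp : p ∈ Finset.Icc 1 n) : n - p + 1 ≤ numUnserved n pre σ p := by
  obtain ⟨hp1, hpn⟩ := Finset.mem_Icc.mp hp
  have hcard : n - p + 1 = (Finset.Icc p n).card := by
    rw [Nat.card_Icc]
    omega
  rw [hcard]
  have hmem {q : ℕ} (hq : q ∈ Finset.Icc p n) : q ∈ Set.Icc 1 n :=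
    ⟨hp1.trans (Finset.mem_Icc.mp hq).1, (Finset.mem_Icc.mp hq).2⟩
  refine Finset.card_le_card_of_injOn σ (fun q hq => ?_)
    fun a ha b hb => hσ.injOn (hmem ha) (hmem hb)
  have hσq : σ q ∈ Finset.Icc 1 n := Finset.mem_Icc.mpr (hσ.mapsTo (hmem hq))
  exact Finset.mem_coe.mpr (Finset.mem_filter.mpr ⟨hσq, (Finset.mem_Icc.mp hq).1.trans
    (le_lastPos (Finset.mem_Icc.mpr (hmem hq)) (hrefl _ hσq))⟩)

theorem Scard_le_numUnserved {n : ℕ} (pre : ℕ → ℕ → Prop) (σ : ℕ → ℕ) {p k : ℕ}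
    (hpk : p ≤ k) (hk : k ∈ Finset.Icc 1 n) :
    Scard n pre (σ k) ≤ numUnserved n pre σ p := by
  rw [Scard, numUnserved, ← Set.ncard_coe_finset]
  exact Set.ncard_le_ncard (fun j hj => Finset.mem_coe.mpr
    (Finset.mem_filter.mpr ⟨hj.1, hpk.trans (le_lastPos hk hj.2)⟩)) (Finset.finite_toSet _)

/-- **Position-based lower bound.** If `n − |S_i| < k ≤ n` and the repair
sequence `σ` visits vertex `i` at the `k`-th position, then `T(σ) ≥ L_i^k`. -/
theorem stmt6
    (n : ℕ) (hn : 1 ≤ n)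
    (d : ℕ → ℕ → ℝ) (hd : ∀ i j, 0 ≤ d i j)
    (pre : ℕ → ℕ → Prop)
    (hrefl : ∀ i ∈ Finset.Icc 1 n, pre i i)
    (htrans : ∀ i j k, pre i j → pre j k → pre i k)
    (hantisymm : ∀ i j, pre i j → pre j i → i = j)
    (σ : ℕ → ℕ) (hσ : Set.BijOn σ (Set.Icc 1 n) (Set.Icc 1 n))
    (i k : ℕ) (hi : i ∈ Finset.Icc 1 n)
    (hk1 : n - Scard n pre i < k) (hk2 : k ≤ n)
    (hσk : σ k = i) :
    Lik n d pre i k ≤ totalT n d pre σ := by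
  have hk : k ∈ Finset.Icc 1 n := Finset.mem_Icc.mpr ⟨by omega, hk2⟩
  have hs := sArc_nonneg hd n
  refine le_trans ?_ (sum_numUnserved_mul_sArc_le_totalT d pre hσ)
  have hIcc (a b : ℕ) : Finset.Icc (a + 1) b = Finset.Ioc a b := Finset.Icc_add_one_left_eq_Ioc a b
  have hbound (p : ℕ) (hp : p ∈ Finset.Ioc 0 n) :
      ((n - p + 1 : ℕ) : ℝ) * sArc n d p ≤ numUnserved n pre σ p * sArc n d p :=
    mul_le_mul_of_nonneg_right
      (Nat.cast_le.mpr (le_numUnserved hrefl hσ (hIcc 0 n ▸ hp))) (hs p)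
  simp only [Lik, hIcc]
  rw [Finset.mul_sum,
    ← Finset.sum_Ioc_consecutive _ (Nat.zero_le k) hk2,
    ← Finset.sum_Ioc_consecutive _ (Nat.zero_le _) hk1.le, add_right_comm]
  refine add_le_add (add_le_add ?_ ?_) ?_
  · exact Finset.sum_le_sum fun p hp =>
      hbound p (Finset.Ioc_subset_Ioc_right (Nat.sub_le _ _) hp)
  · refine Finset.sum_le_sum fun p hp => mul_le_mul_of_nonneg_right (Nat.cast_le.mpr ?_) (hs p)
    exact hσk ▸ Scard_le_numUnserved pre σ (Finset.mem_Ioc.mp hp).2 hk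
  · exact Finset.sum_le_sum fun p hp => hbound p (Finset.Ioc_subset_Ioc_left (Nat.zero_le k) hp)
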